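/- Let g : (0, ∞) → [0, ∞) be measurable and satisfy g(x) = Σ_{k≥1} Σ_{a odd, 0 < a < 2^k} (1/(a + 2^k x))² g(1/(a + 2^k x)) for all x > 0 (g is a fixed point of Vallée's operator V₂), and assume ∫₀^∞ g(t) dt = 1. Let G(x) = ∫₀ˣ g(t) dt. Then Σ_{a odd, a > 0} 2^{−⌊log₂ a⌋} G(1/a) = 1, where the sum is over all positive odd integers a. -/

import Mathlib

/-- Vallée's operator
`V₂[g](x) = Σ_{k≥1} Σ_{a odd, 0 < a < 2^k} (1/(a+2^k x))² · g(1/(a+2^k x))`. -/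
noncomputable def opV2 (g : ℝ → ℝ) (x : ℝ) : ℝ :=
  ∑' k : ℕ, ∑' a : ℕ,
    if Odd a ∧ 0 < a ∧ a < 2 ^ (k + 1) then
      (1 / (a + 2 ^ (k + 1) * x)) ^ 2 * g (1 / (a + 2 ^ (k + 1) * x))
    else 0

open MeasureTheory Set
open scoped ENNReal

theorem lintegral_comp_one_div_affine (g : ℝ → ℝ) {a b : ℝ} (ha : 0 < a) (hb : 0 < b)
    {s : Set ℝ} (hs : MeasurableSet s) (hs0 : s ⊆ Ioi 0) :
    ∫⁻ x in s, ENNReal.ofReal ((1 / (a + b * x)) ^ 2 * g (1 / (a + b * x))) =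
      ENNReal.ofReal b⁻¹ * ∫⁻ u in (fun x => 1 / (a + b * x)) '' s, ENNReal.ofReal (g u) := by
  have hpos : ∀ x ∈ s, 0 < a + b * x := fun x hx => by
    have : 0 < x := hs0 hx
    positivity
  rw [lintegral_image_eq_lintegral_abs_deriv_mul (f' := fun x => -b / (a + b * x) ^ 2) hs,
    ← lintegral_const_mul' _ _ ENNReal.ofReal_ne_top]
  · refine setLIntegral_congr_fun hs fun x hx => ?_
    have := hpos x hx
    rw [← ENNReal.ofReal_mul (abs_nonneg _), ← ENNReal.ofReal_mul (by positivity), abs_div,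
      abs_neg, abs_of_pos hb, abs_of_pos (by positivity : 0 < (a + b * x) ^ 2)]
    congr 1
    field_simp
  · intro x hx
    have h : HasDerivAt (fun x => a + b * x) b x := by
      simpa using ((hasDerivAt_id x).const_mul b).const_add a
    simpa only [one_div] using (h.fun_inv (hpos x hx).ne').hasDerivWithinAt
  · intro x hx y hy hxy
    have := hpos x hx
    have := hpos y hy
    have h : a + b * x = a + b * y := by simpa using hxy
    exact mul_left_cancel₀ hb.ne' (add_left_cancel h)

theorem image_one_div_affine_Ioi {a b : ℝ} (ha : 0 < a) (hb : 0 < b) :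
    (fun x => 1 / (a + b * x)) '' Ioi 0 = Ioo 0 (1 / a) := by
  ext u
  simp only [mem_image, mem_Ioi, mem_Ioo]
  constructor
  · rintro ⟨x, hx, rfl⟩
    exact ⟨by positivity, one_div_lt_one_div_of_lt ha (by nlinarith [mul_pos hb hx])⟩
  · rintro ⟨hu, hua⟩
    have h : a < 1 / u := (lt_one_div ha hu).2 hua
    refine ⟨(1 / u - a) / b, div_pos (sub_pos.2 h) hb, ?_⟩
    field_simp
    ring

/-- The real interval `[2^{-(m+n)}, 2^{n-m}]`. -/
def dyadicWindow (n m : ℕ) : Set ℝ := Icc (1 / 2 ^ (m + n)) (2 ^ n / 2 ^ m)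

theorem tsum_indicator_dyadicWindow_le (n : ℕ) (u : ℝ) :
    ∑' m : ℕ, (dyadicWindow n m).indicator (fun _ => (1 : ℝ≥0∞)) u ≤ 2 * n + 1 := by
  classical
  by_cases h : ∃ m, u ∈ dyadicWindow n m
  · have hmem := Nat.find_spec h
    set m₀ := Nat.find h
    rw [tsum_eq_sum (s := Finset.Icc m₀ (m₀ + 2 * n))]
    · calc _ ≤ ∑ m ∈ Finset.Icc m₀ (m₀ + 2 * n), (1 : ℝ≥0∞) :=
            Finset.sum_le_sum fun m _ => indicator_le_self' (by simp) u
        _ = 2 * n + 1 := by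
            simp only [Finset.sum_const, Nat.card_Icc, nsmul_eq_mul, mul_one]
            rw [show m₀ + 2 * n + 1 - m₀ = 2 * n + 1 by omega]
            push_cast
            rfl
    · intro m hm
      refine indicator_of_notMem (fun hu => hm ?_) _
      refine Finset.mem_Icc.2 ⟨Nat.find_min' h hu, ?_⟩
      have h1 : (1 : ℝ) / 2 ^ (m₀ + n) ≤ 2 ^ n / 2 ^ m := hmem.1.trans hu.2
      rw [div_le_div_iff₀ (by positivity) (by positivity), one_mul, ← pow_add] at h1
      have := (pow_le_pow_iff_right₀ (by norm_num : (1 : ℝ) < 2)).1 h1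
      omega
  · push Not at h
    simp [indicator_of_notMem (h _)]

theorem tsum_lintegral_dyadicWindow_le {F : ℝ → ℝ≥0∞} (hF : Measurable F) (n : ℕ) :
    ∑' m : ℕ, ∫⁻ u in dyadicWindow n m, F u ≤ (2 * n + 1) * ∫⁻ u in Ioi 0, F u := by
  have hw : ∀ m, MeasurableSet (dyadicWindow n m) := fun m => measurableSet_Icc
  have hsub : ∀ m, dyadicWindow n m ⊆ Ioi 0 := fun m u hu =>
    lt_of_lt_of_le (by positivity) hu.1
  calc ∑' m : ℕ, ∫⁻ u in dyadicWindow n m, F u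
      = ∑' m : ℕ, ∫⁻ u in Ioi 0, (dyadicWindow n m).indicator (fun _ => (1 : ℝ≥0∞)) u * F u := by
        refine tsum_congr fun m => ?_
        have : ∀ u, (dyadicWindow n m).indicator (fun _ => (1 : ℝ≥0∞)) u * F u =
            (dyadicWindow n m).indicator F u := fun u => by
          by_cases hu : u ∈ dyadicWindow n m <;> simp [hu]
        simp_rw [this]
        rw [setLIntegral_indicator (hw m), inter_eq_left.2 (hsub m)]
    _ = ∫⁻ u in Ioi 0, ∑' m : ℕ, (dyadicWindow n m).indicator (fun _ => (1 : ℝ≥0∞)) u * F u :=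
        (lintegral_tsum fun m =>
          ((measurable_const.indicator (hw m)).mul hF).aemeasurable).symm
    _ ≤ ∫⁻ u in Ioi 0, (2 * n + 1) * F u := by
        refine lintegral_mono fun u => ?_
        rw [ENNReal.tsum_mul_right]
        gcongr
        exact tsum_indicator_dyadicWindow_le n u
    _ = _ := lintegral_const_mul _ hF

/-- The `(k, a)` summand of Vallée's operator. -/
noncomputable def opV2Term (g : ℝ → ℝ) (k a : ℕ) (x : ℝ) : ℝ :=
  if Odd a ∧ 0 < a ∧ a < 2 ^ (k + 1) then
    (1 / (a + 2 ^ (k + 1) * x)) ^ 2 * g (1 / (a + 2 ^ (k + 1) * x))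
  else 0

theorem opV2_eq_tsum_opV2Term (g : ℝ → ℝ) (x : ℝ) :
    opV2 g x = ∑' k : ℕ, ∑' a : ℕ, opV2Term g k a x := rfl

theorem measurable_opV2Term {g : ℝ → ℝ} (hg : Measurable g) (k a : ℕ) :
    Measurable (opV2Term g k a) := by
  unfold opV2Term
  split_ifs <;> fun_prop

theorem opV2Term_nonneg {g : ℝ → ℝ} (hg : ∀ x : ℝ, 0 < x → 0 ≤ g x) (k a : ℕ) {x : ℝ}
    (hx : 0 < x) : 0 ≤ opV2Term g k a x := by
  unfold opV2Term
  split_ifs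
  · exact mul_nonneg (sq_nonneg _) (hg _ (by positivity))
  · exact le_rfl

/-- Vallée's operator with values in `[0, ∞]`. -/
noncomputable def eopV2 (g : ℝ → ℝ) (x : ℝ) : ℝ≥0∞ :=
  ∑' k : ℕ, ∑' a : ℕ, ENNReal.ofReal (opV2Term g k a x)

theorem measurable_eopV2 {g : ℝ → ℝ} (hg : Measurable g) : Measurable (eopV2 g) :=
  Measurable.tsum fun k => Measurable.tsum fun a =>
    (measurable_opV2Term hg k a).ennreal_ofReal

theorem opV2_eq_toReal_eopV2 {g : ℝ → ℝ} (hg : ∀ x : ℝ, 0 < x → 0 ≤ g x) {x : ℝ} (hx : 0 < x)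
    (hfin : eopV2 g x ≠ ∞) : opV2 g x = (eopV2 g x).toReal := by
  rw [eopV2, ENNReal.tsum_toReal_eq (ENNReal.ne_top_of_tsum_ne_top hfin), opV2_eq_tsum_opV2Term]
  refine tsum_congr fun k => ?_
  rw [ENNReal.tsum_toReal_eq fun a => ENNReal.ofReal_ne_top]
  exact tsum_congr fun a => (ENNReal.toReal_ofReal (opV2Term_nonneg hg k a hx)).symm

theorem lintegral_eopV2 {g : ℝ → ℝ} (hg : Measurable g) (s : Set ℝ) :
    ∫⁻ x in s, eopV2 g x = ∑' k : ℕ, ∑' a : ℕ, ∫⁻ x in s, ENNReal.ofReal (opV2Term g k a x) := by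
  have hm : ∀ k a, Measurable fun x => ENNReal.ofReal (opV2Term g k a x) := fun k a =>
    (measurable_opV2Term hg k a).ennreal_ofReal
  unfold eopV2
  rw [lintegral_tsum fun k => (Measurable.tsum (hm k)).aemeasurable]
  exact tsum_congr fun k => lintegral_tsum fun a => (hm k a).aemeasurable

theorem lintegral_opV2Term (g : ℝ → ℝ) (k a : ℕ) {s : Set ℝ} (hs : MeasurableSet s)
    (hs0 : s ⊆ Ioi 0) :
    ∫⁻ x in s, ENNReal.ofReal (opV2Term g k a x) =
      if Odd a ∧ a < 2 ^ (k + 1) then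
        2⁻¹ ^ (k + 1) *
          ∫⁻ u in (fun x : ℝ => 1 / ((a : ℝ) + 2 ^ (k + 1) * x)) '' s, ENNReal.ofReal (g u)
      else 0 := by
  have h : (Odd a ∧ 0 < a ∧ a < 2 ^ (k + 1)) ↔ Odd a ∧ a < 2 ^ (k + 1) :=
    ⟨fun h => ⟨h.1, h.2.2⟩, fun h => ⟨h.1, h.1.pos, h.2⟩⟩
  simp only [opV2Term, h]
  split_ifs with hc
  · rw [lintegral_comp_one_div_affine g (Nat.cast_pos.2 hc.1.pos) (by positivity) hs hs0]
    congr 1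
    rw [← inv_pow, ENNReal.ofReal_pow (by positivity), ENNReal.ofReal_inv_of_pos (by positivity)]
    simp
  · simp

theorem lintegral_eopV2_lt_top {g : ℝ → ℝ} (hg : Measurable g) (n : ℕ)
    (hfin : ∫⁻ u in Ioi 0, ENNReal.ofReal (g u) ≠ ∞) :
    ∫⁻ x in Icc (1 / 2 ^ n) (2 ^ n - 1), eopV2 g x < ∞ := by
  have hs0 : Icc ((1 : ℝ) / 2 ^ n) (2 ^ n - 1) ⊆ Ioi 0 := fun x hx =>
    lt_of_lt_of_le (by positivity) hx.1
  have key : ∀ k a : ℕ, ∫⁻ x in Icc (1 / 2 ^ n) (2 ^ n - 1), ENNReal.ofReal (opV2Term g k a x) ≤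
      if a < 2 ^ (k + 1) then
        2⁻¹ ^ (k + 1) * ∫⁻ u in dyadicWindow n (k + 1), ENNReal.ofReal (g u) else 0 := by
    intro k a
    rw [lintegral_opV2Term g k a measurableSet_Icc hs0]
    by_cases ha : a < 2 ^ (k + 1)
    · by_cases ho : Odd a
      · simp only [ha, ho, and_self, if_true]
        gcongr
        rintro _ ⟨x, hx, rfl⟩
        have hx0 : 0 < x := hs0 hx
        have ha' : (a : ℝ) ≤ 2 ^ (k + 1) := by exact_mod_cast ha.le
        have h2 : (0 : ℝ) < 2 ^ (k + 1) := by positivity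
        constructor
        · apply one_div_le_one_div_of_le (by positivity)
          rw [pow_add _ (k + 1)]
          nlinarith [mul_le_mul_of_nonneg_left hx.2 h2.le]
        · rw [div_le_div_iff₀ (by positivity) h2]
          have h3 : 1 ≤ 2 ^ n * x := by
            have := hx.1
            rwa [div_le_iff₀' (by positivity)] at this
          have h4 : (0 : ℝ) ≤ 2 ^ n * a := by positivity
          nlinarith
      · simp [ho]
    · simp [ha]
  calc ∫⁻ x in Icc (1 / 2 ^ n) (2 ^ n - 1), eopV2 g x
      ≤ ∑' k : ℕ, ∑' a : ℕ, if a < 2 ^ (k + 1) then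
          2⁻¹ ^ (k + 1) * ∫⁻ u in dyadicWindow n (k + 1), ENNReal.ofReal (g u) else 0 := by
        rw [lintegral_eopV2 hg]
        exact ENNReal.tsum_le_tsum fun k => ENNReal.tsum_le_tsum fun a => key k a
    _ = ∑' k : ℕ, ∫⁻ u in dyadicWindow n (k + 1), ENNReal.ofReal (g u) := by
        refine tsum_congr fun k => ?_
        rw [tsum_eq_sum (s := Finset.range (2 ^ (k + 1))) (fun a ha => by
          rw [if_neg (by simpa using ha)]), Finset.sum_congr rfl (fun a ha => if_pos
            (Finset.mem_range.1 ha)), Finset.sum_const, Finset.card_range, nsmul_eq_mul,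
          ← mul_assoc]
        push_cast
        rw [← mul_pow, ENNReal.mul_inv_cancel (by simp) (by simp), one_pow, one_mul]
    _ ≤ ∑' m : ℕ, ∫⁻ u in dyadicWindow n m, ENNReal.ofReal (g u) :=
        ENNReal.tsum_comp_le_tsum_of_injective (add_left_injective 1) _
    _ ≤ (2 * n + 1) * ∫⁻ u in Ioi 0, ENNReal.ofReal (g u) :=
        tsum_lintegral_dyadicWindow_le hg.ennreal_ofReal n
    _ < ∞ := ENNReal.mul_lt_top (by finiteness) hfin.lt_top

theorem iUnion_Icc_dyadic : ⋃ n : ℕ, Icc ((1 : ℝ) / 2 ^ n) (2 ^ n - 1) = Ioi 0 := by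
  ext x
  simp only [mem_iUnion, mem_Ioi]
  constructor
  · rintro ⟨n, hx⟩
    exact lt_of_lt_of_le (by positivity) hx.1
  · intro hx
    obtain ⟨n, hn⟩ := pow_unbounded_of_one_lt (max (1 / x) (x + 1)) (one_lt_two (α := ℝ))
    refine ⟨n, ?_, ?_⟩
    · exact (one_div_le (by positivity) hx).2 ((le_max_left _ _).trans hn.le)
    · linarith [(le_max_right (1 / x) (x + 1)).trans hn.le]

theorem ae_eopV2_lt_top {g : ℝ → ℝ} (hg : Measurable g)
    (hfin : ∫⁻ u in Ioi 0, ENNReal.ofReal (g u) ≠ ∞) :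
    ∀ᵐ x ∂volume.restrict (Ioi (0 : ℝ)), eopV2 g x < ∞ := by
  rw [← iUnion_Icc_dyadic, ae_restrict_iUnion_iff]
  exact fun n => ae_lt_top (measurable_eopV2 hg) (lintegral_eopV2_lt_top hg n hfin).ne

theorem tsum_two_inv_pow_of_lt_two_pow {a : ℕ} (ha : a ≠ 0) :
    ∑' k : ℕ, (if a < 2 ^ (k + 1) then (2⁻¹ : ℝ≥0∞) ^ (k + 1) else 0) = 2⁻¹ ^ Nat.log 2 a := by
  have h : ∀ k, a < 2 ^ (k + 1) ↔ Nat.log 2 a ≤ k := fun k => by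
    rw [← Nat.log_lt_iff_lt_pow one_lt_two ha, Nat.lt_succ_iff]
  simp only [h]
  rw [← Summable.sum_add_tsum_nat_add' (k := Nat.log 2 a) ENNReal.summable,
    Finset.sum_eq_zero fun k hk => if_neg (by simpa using hk), zero_add]
  simp only [Nat.le_add_left, if_true]
  calc ∑' k : ℕ, (2⁻¹ : ℝ≥0∞) ^ (k + Nat.log 2 a + 1)
      = ∑' k : ℕ, 2⁻¹ ^ Nat.log 2 a * 2⁻¹ ^ (k + 1) :=
        tsum_congr fun k => by ring
    _ = 2⁻¹ ^ Nat.log 2 a := by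
        rw [ENNReal.tsum_mul_left, ENNReal.tsum_geometric_add_one, ENNReal.one_sub_inv_two,
          inv_inv, ENNReal.inv_mul_cancel (by simp) (by simp), mul_one]

theorem lintegral_Ioi_eopV2 {g : ℝ → ℝ} (hg : Measurable g) :
    ∫⁻ x in Ioi 0, eopV2 g x = ∑' a : ℕ, if Odd a then
      2⁻¹ ^ Nat.log 2 a * ∫⁻ u in Ioo 0 (1 / (a : ℝ)), ENNReal.ofReal (g u) else 0 := by
  rw [lintegral_eopV2 hg, ENNReal.tsum_comm]
  refine tsum_congr fun a => ?_
  simp only [lintegral_opV2Term g _ a measurableSet_Ioi subset_rfl]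
  split_ifs with ho
  · rw [← tsum_two_inv_pow_of_lt_two_pow ho.pos.ne', ← ENNReal.tsum_mul_right]
    refine tsum_congr fun k => ?_
    rw [image_one_div_affine_Ioi (Nat.cast_pos.2 ho.pos) (by positivity)]
    simp [ho, ite_mul]
  · simp [ho]

/-- If `g ≥ 0` on `(0,∞)` is a measurable fixed point of Vallée's operator `V₂`
normalised by `∫₀^∞ g = 1`, then with `G(x) = ∫₀ˣ g` one has
`Σ_{a odd, a > 0} 2^{−⌊log₂ a⌋} G(1/a) = 1`. -/
theorem sum_over_odd_G_eq_one (g : ℝ → ℝ) (hmeas : Measurable g)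
    (hnonneg : ∀ x : ℝ, 0 < x → 0 ≤ g x)
    (hfix : ∀ x : ℝ, 0 < x → g x = opV2 g x)
    (hint : MeasureTheory.IntegrableOn g (Set.Ioi (0 : ℝ)))
    (hnorm : ∫ t in Set.Ioi (0 : ℝ), g t = 1)
    (G : ℝ → ℝ) (hG : ∀ x, G x = ∫ t in (0 : ℝ)..x, g t) :
    ∑' a : ℕ, (if Odd a then (1 / 2 : ℝ) ^ (Nat.log 2 a) * G (1 / a) else 0) = 1 := by
  have hpos : ∀ s ⊆ Ioi (0 : ℝ), MeasurableSet s → 0 ≤ᵐ[volume.restrict s] g := fun s hs hms =>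
    (ae_restrict_iff' hms).2 (.of_forall fun x hx => hnonneg x (hs hx))
  have hone : ∫⁻ u in Ioi 0, ENNReal.ofReal (g u) = 1 := by
    rw [← ofReal_integral_eq_lintegral_ofReal hint (hpos _ subset_rfl measurableSet_Ioi), hnorm,
      ENNReal.ofReal_one]
  have hV : ∫⁻ x in Ioi 0, eopV2 g x = 1 := by
    rw [← hone]
    refine lintegral_congr_ae ?_
    filter_upwards [ae_eopV2_lt_top hmeas (by simp [hone]), ae_restrict_mem measurableSet_Ioi]
      with x hx hx0
    rw [hfix x hx0, opV2_eq_toReal_eopV2 hnonneg hx0 hx.ne, ENNReal.ofReal_toReal hx.ne]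
  rw [lintegral_Ioi_eopV2 hmeas] at hV
  have hV' := congrArg ENNReal.toReal hV
  rw [ENNReal.tsum_toReal_eq (ENNReal.ne_top_of_tsum_ne_top (hV.trans_ne ENNReal.one_ne_top)),
    ENNReal.toReal_one] at hV'
  refine (tsum_congr fun a => ?_).trans hV'
  split_ifs
  · rw [ENNReal.toReal_mul, hG, intervalIntegral.integral_of_le (by positivity),
      integral_Ioc_eq_integral_Ioo, integral_eq_lintegral_of_nonneg_ae
        (hpos _ Ioo_subset_Ioi_self measurableSet_Ioo) hmeas.aestronglyMeasurable]
    simp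
  · rfl
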